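/- arXiv:1205.3513 — 8 statements merged into one kernel-verified Lean document; each statement's English description precedes it below -/
import Mathlib

section
/- Let α, β ∈ ℍ be quaternions such that β does not lie on the 2-sphere Re(α) + |Im(α)|·𝕊 of α (i.e. Re(β) ≠ Re(α) or |Im(β)| ≠ |Im(α)|). Then α ≠ conj(β), and the zero set of the quadratic polynomial P(q) = q² − q(α+β) + αβ (which is the star product (q−α)*(q−β)) consists of exactly the two distinct points α and (α − conj(β))·β·(α − conj(β))⁻¹. -/
open Quaternion

namespace Quaternion

/-- The real part of `p * b * star p` is `normSq p * b.re`. -/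
lemma re_mul_mul_star (p b : ℍ) : (p * b * star p).re = normSq p * b.re := by
  simp only [re_mul, imI_mul, imJ_mul, imK_mul, re_star, imI_star, imJ_star, imK_star,
    normSq_def']
  ring

/-- Conjugate quaternions have the same real part. -/
lemma re_eq_of_mul_eq_mul {p q b : ℍ} (hp : p ≠ 0) (h : q * p = p * b) : q.re = b.re := by
  have h1 := re_mul_mul_star p b
  rw [← h, mul_assoc, self_mul_star, mul_coe_eq_smul, re_smul, smul_eq_mul] at h1
  exact mul_left_cancel₀ (normSq_ne_zero.2 hp) h1

/-- Conjugate quaternions have the same squared norm. -/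
lemma normSq_eq_of_mul_eq_mul {p q b : ℍ} (hp : p ≠ 0) (h : q * p = p * b) :
    normSq q = normSq b := by
  have h1 := congrArg normSq h
  rw [map_mul, map_mul, mul_comm] at h1
  exact mul_left_cancel₀ (normSq_ne_zero.2 hp) h1

/-- A quaternion conjugate to `b` is a root of the characteristic polynomial of `b`. -/
lemma mul_add_star_sub_of_mul_eq_mul {p q b : ℍ} (hp : p ≠ 0) (h : q * p = p * b) :
    q * (b + star b - q) = star b * b := by
  have hs : b + star b - q = star q := by
    rw [self_add_star, ← re_eq_of_mul_eq_mul hp h, ← self_add_star, add_sub_cancel_left]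
  rw [hs, self_mul_star, star_mul_self, normSq_eq_of_mul_eq_mul hp h]

/-- On the conjugacy class of `b`, the polynomial `(q - a) * (q - b)` reduces to a linear one. -/
lemma star_product_eq_of_mul_eq_mul {p q b : ℍ} (a : ℍ) (hp : p ≠ 0) (h : q * p = p * b) :
    q ^ 2 - q * (a + b) + a * b = (a - star b) * b - q * (a - star b) := by
  have hE := mul_add_star_sub_of_mul_eq_mul hp h
  rw [sub_mul, ← hE]
  noncomm_ring

lemma norm_im_eq_of_re_eq_of_normSq_eq {a b : ℍ} (hr : a.re = b.re)
    (hn : normSq a = normSq b) : ‖a.im‖ = ‖b.im‖ := by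
  have key : normSq a.im = normSq b.im := by
    simp only [normSq_def', re_im, imI_im, imJ_im, imK_im] at hn ⊢
    rw [hr] at hn
    linarith
  rw [normSq_eq_norm_mul_self, normSq_eq_norm_mul_self] at key
  exact (mul_self_inj (norm_nonneg _) (norm_nonneg _)).1 key

end Quaternion

/-- If `β` does not lie on the 2-sphere `Re α + |Im α|·𝕊` of `α`
(i.e. `Re β ≠ Re α` or `|Im β| ≠ |Im α|`), then `α ≠ conj β`, the two points
`α` and `(α - conj β) β (α - conj β)⁻¹` are distinct, and the zero set of
`P(q) = q² - q(α+β) + αβ = (q-α)*(q-β)` is exactly `{α, (α - conj β) β (α - conj β)⁻¹}`. -/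
theorem statement0 (α β : ℍ) (h : β.re ≠ α.re ∨ ‖β.im‖ ≠ ‖α.im‖) :
    α ≠ star β ∧
    α ≠ (α - star β) * β * (α - star β)⁻¹ ∧
    {q : ℍ | q ^ 2 - q * (α + β) + α * β = 0} =
      {α, (α - star β) * β * (α - star β)⁻¹} := by
  have hnot : ¬ (α.re = β.re ∧ normSq α = normSq β) := fun ⟨hr, hn⟩ =>
    h.elim (fun h => h hr.symm) fun h => h (norm_im_eq_of_re_eq_of_normSq_eq hr hn).symm
  have hne : α ≠ star β := by
    rintro rfl
    exact hnot ⟨re_star β, normSq_star β⟩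
  have hc : α - star β ≠ 0 := sub_ne_zero.2 hne
  refine ⟨hne, fun he => ?_, ?_⟩
  · have he' := (eq_mul_inv_iff_mul_eq₀ hc).1 he
    exact hnot ⟨re_eq_of_mul_eq_mul hc he', normSq_eq_of_mul_eq_mul hc he'⟩
  · ext q
    simp only [Set.mem_ofPred_eq, Set.mem_insert_iff, Set.mem_singleton_iff]
    rw [eq_mul_inv_iff_mul_eq₀ hc]
    constructor
    · intro hq
      refine or_iff_not_imp_left.2 fun hqα => ?_
      have hp : q * (q - α) = (q - α) * β := by
        rw [← sub_eq_zero, ← hq]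
        noncomm_ring
      rw [star_product_eq_of_mul_eq_mul α (sub_ne_zero.2 hqα) hp] at hq
      exact (sub_eq_zero.1 hq).symm
    · rintro (rfl | hq)
      · noncomm_ring
      · rw [star_product_eq_of_mul_eq_mul α hc hq, hq, sub_self]
end

section
/- Let I ∈ 𝕊, let y₀ ∈ ℝ with y₀ ≠ 0, and let A₁, A₂ ∈ ℍ. Let L_I = ℝ + ℝI and let L_I^⊥ be its orthogonal complement in ℍ ≅ ℝ⁴ with the standard Euclidean inner product, and let T : ℍ → ℍ be the unique ℝ-linear map such that T(u) = u·(A₁ + 2y₀I·A₂) for all u ∈ L_I and T(w) = w·A₁ for all w ∈ L_I^⊥. Then: (i) if A₁ = 0 and A₂ = 0 then T = 0; (ii) if A₁ = 0 and A₂ ≠ 0 then the kernel of T is exactly L_I^⊥ (so T has rank 2); (iii) if A₁ ≠ 0 then T is bijective if and only if 1 + 2y₀I·A₂·A₁⁻¹ ∉ L_I^⊥, and when T is not bijective its kernel has real dimension 2. -/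
open Quaternion Submodule

namespace Quaternion

lemma star_eq_neg_of_sq_eq_neg_one {I : ℍ} (hI : I ^ 2 = -1) : star I = -I := by
  have h1 : normSq I = 1 := by
    have h : normSq I ^ 2 = 1 := by rw [← map_pow, hI, normSq_neg, map_one]
    nlinarith [normSq_nonneg (a := I)]
  have h2 : star I * I = 1 := by rw [star_mul_self, h1, coe_one]
  calc star I = -(star I * I ^ 2) := by rw [hI]; simp
    _ = -(star I * I * I) := by rw [sq, mul_assoc]
    _ = -I := by rw [h2, one_mul]

lemma inner_mul_right_eq (u v w : ℍ) : inner ℝ v (u * w) = inner ℝ (star u * v) w := by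
  rw [inner_def, inner_def, star_mul, ← mul_assoc, mul_assoc (star u)]
  simp only [re_mul]
  ring

lemma star_mul_mem_span_one_pair {I : ℍ} (hI : I ^ 2 = -1) {u v : ℍ}
    (hu : u ∈ span ℝ ({1, I} : Set ℍ)) (hv : v ∈ span ℝ ({1, I} : Set ℍ)) :
    star u * v ∈ span ℝ ({1, I} : Set ℍ) := by
  obtain ⟨a, b, rfl⟩ := mem_span_pair.1 hu
  obtain ⟨c, d, rfl⟩ := mem_span_pair.1 hv
  refine mem_span_pair.2 ⟨a * c + b * d, a * d - b * c, ?_⟩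
  have h : I * I = -1 := by rw [← sq, hI]
  simp only [star_add, star_smul, star_one, star_eq_neg_of_sq_eq_neg_one hI,
    add_mul, mul_add, smul_mul_smul_comm, neg_mul, one_mul, mul_one, h, neg_neg]
  module

lemma mul_mem_orthogonal_span_one_pair {I : ℍ} (hI : I ^ 2 = -1) {u w : ℍ}
    (hu : u ∈ span ℝ ({1, I} : Set ℍ)) (hw : w ∈ (span ℝ ({1, I} : Set ℍ))ᗮ) :
    u * w ∈ (span ℝ ({1, I} : Set ℍ))ᗮ := fun v hv ↦ by
  rw [inner_mul_right_eq]
  exact hw _ (star_mul_mem_span_one_pair hI hu hv)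

lemma mem_orthogonal_of_mul_mem {I : ℍ} (hI : I ^ 2 = -1) {u w : ℍ}
    (hu : u ∈ span ℝ ({1, I} : Set ℍ)) (hu0 : u ≠ 0)
    (h : u * w ∈ (span ℝ ({1, I} : Set ℍ))ᗮ) : w ∈ (span ℝ ({1, I} : Set ℍ))ᗮ := by
  have hinv : u⁻¹ ∈ span ℝ ({1, I} : Set ℍ) := by
    have h1 := star_mul_mem_span_one_pair hI hu (subset_span (Set.mem_insert 1 {I}))
    rw [mul_one] at h1
    exact smul_mem _ (normSq u)⁻¹ h1
  simpa [← mul_assoc, hu0] using mul_mem_orthogonal_span_one_pair hI hinv h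

lemma finrank_span_one_pair {I : ℍ} (hI : I ^ 2 = -1) :
    Module.finrank ℝ (span ℝ ({1, I} : Set ℍ)) = 2 := by
  have hre : I.re = 0 := by
    have h := congrArg QuaternionAlgebra.re (star_eq_neg_of_sq_eq_neg_one hI)
    simp only [re_star, re_neg] at h
    linarith
  have hI0 : I ≠ 0 := by rintro rfl; simp at hI
  have hli : LinearIndependent ℝ ![(1 : ℍ), I] := by
    refine LinearIndependent.pair_iff.2 fun s t h ↦ ?_
    have hs : s = 0 := by simpa [hre] using congrArg QuaternionAlgebra.re h
    subst hs
    simpa [hI0] using h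
  rw [← Matrix.range_cons_cons_empty 1 I ![], finrank_span_eq_card hli, Fintype.card_fin]

end Quaternion

/-- Rank properties of the model `T` of the real differential of a
slice regular function at `q₀ = x₀ + I y₀`: `T u = u (A₁ + 2 y₀ I A₂)` on
`L_I = ℝ + ℝI` and `T w = w A₁` on the orthogonal complement `L_I^⊥`. -/
theorem statement1 (I : ℍ) (hI : I ^ 2 = -1) (y₀ : ℝ) (hy₀ : y₀ ≠ 0)
    (A₁ A₂ : ℍ) (T : ℍ →ₗ[ℝ] ℍ)
    (L : Submodule ℝ ℍ) (hL : L = Submodule.span ℝ ({1, I} : Set ℍ))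
    (hTu : ∀ u ∈ L, T u = u * (A₁ + ((2 * y₀ : ℝ) : ℍ) * I * A₂))
    (hTw : ∀ w ∈ Lᗮ, T w = w * A₁) :
    (A₁ = 0 → A₂ = 0 → T = 0) ∧
    (A₁ = 0 → A₂ ≠ 0 → LinearMap.ker T = Lᗮ ∧
      Module.finrank ℝ (LinearMap.range T) = 2) ∧
    (A₁ ≠ 0 →
      (Function.Bijective T ↔ 1 + ((2 * y₀ : ℝ) : ℍ) * I * A₂ * A₁⁻¹ ∉ Lᗮ) ∧
      (¬ Function.Bijective T → Module.finrank ℝ (LinearMap.ker T) = 2)) := by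
  have hdim : Module.finrank ℝ L = 2 := hL ▸ finrank_span_one_pair hI
  have hI0 : I ≠ 0 := by rintro rfl; simp at hI
  have hdec : ∀ q : ℍ, ∃ u ∈ L, ∃ w ∈ Lᗮ, q = u + w := fun q ↦ by
    obtain ⟨u, hu, w, hw, h⟩ := L.exists_add_mem_mem_orthogonal q
    exact ⟨u, hu, w, hw, h⟩
  refine ⟨?_, ?_, ?_⟩
  · rintro rfl rfl
    ext1 q
    obtain ⟨u, hu, w, hw, rfl⟩ := hdec q
    simp [hTu u hu, hTw w hw]
  · rintro rfl hA₂
    have hker : LinearMap.ker T = Lᗮ := by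
      ext q
      refine ⟨fun hq ↦ ?_, fun hq ↦ by simp [hTw q hq]⟩
      obtain ⟨u, hu, w, hw, rfl⟩ := hdec q
      have hc : ((2 * y₀ : ℝ) : ℍ) ≠ 0 := by
        rw [Ne, ← Quaternion.coe_zero, coe_inj]
        positivity
      have hu0 : u = 0 := by
        rw [LinearMap.mem_ker, map_add, hTu u hu, hTw w hw, mul_zero, add_zero, zero_add] at hq
        exact (mul_eq_zero.1 hq).resolve_right (mul_ne_zero (mul_ne_zero hc hI0) hA₂)
      simpa [hu0] using hw
    refine ⟨hker, ?_⟩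
    have h1 := T.finrank_range_add_finrank_ker
    have h2 := L.finrank_add_finrank_orthogonal
    rw [hker] at h1
    omega
  · intro hA₁
    set B : ℍ := 1 + ((2 * y₀ : ℝ) : ℍ) * I * A₂ * A₁⁻¹ with hB
    have hBA : A₁ + ((2 * y₀ : ℝ) : ℍ) * I * A₂ = B * A₁ := by
      rw [hB, add_mul, one_mul, inv_mul_cancel_right₀ hA₁]
    have hT : ∀ u ∈ L, ∀ w ∈ Lᗮ, (T (u + w) = 0 ↔ w = -(u * B)) := fun u hu w hw ↦ by
      rw [map_add, hTu u hu, hTw w hw, hBA, ← mul_assoc, ← add_mul, mul_eq_zero,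
        or_iff_left hA₁, add_eq_zero_iff_neg_eq, eq_comm]
    have hinj : B ∉ Lᗮ → Function.Bijective T := fun hBL ↦ by
      have h : Function.Injective T := by
        rw [injective_iff_map_eq_zero]
        intro q hq
        obtain ⟨u, hu, w, hw, rfl⟩ := hdec q
        have hw' := (hT u hu w hw).1 hq
        have hu0 : u = 0 := by
          by_contra hu0
          refine hBL ?_
          rw [hw', neg_mem_iff] at hw
          subst hL
          exact mem_orthogonal_of_mul_mem hI hu hu0 hw
        simp [hw', hu0]
      exact ⟨h, LinearMap.injective_iff_surjective.1 h⟩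
    have hker : B ∈ Lᗮ → Module.finrank ℝ (LinearMap.ker T) = 2 := fun hBL ↦ by
      have hmul : ∀ u ∈ L, u * B ∈ Lᗮ := fun u hu ↦ by
        subst hL
        exact mul_mem_orthogonal_span_one_pair hI hu hBL
      let φ : L →ₗ[ℝ] ℍ := (LinearMap.id - LinearMap.mulRight ℝ B) ∘ₗ L.subtype
      have hφ : ∀ u : L, φ u = u + -(u * B) := fun u ↦ sub_eq_add_neg _ _
      have hφinj : Function.Injective φ := by
        rw [injective_iff_map_eq_zero]
        intro u hu
        rw [hφ, ← sub_eq_add_neg, sub_eq_zero] at hu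
        have hu' : (u : ℍ) ∈ Lᗮ := hu ▸ hmul u u.2
        exact Subtype.ext (inner_self_eq_zero.1 (hu' u u.2))
      have hrange : LinearMap.range φ = LinearMap.ker T := by
        ext q
        constructor
        · rintro ⟨u, rfl⟩
          rw [hφ, LinearMap.mem_ker, hT u u.2 _ (neg_mem (hmul u u.2))]
        · intro hq
          obtain ⟨u, hu, w, hw, rfl⟩ := hdec q
          exact ⟨⟨u, hu⟩, by rw [hφ, (hT u hu w hw).1 hq]⟩
      rw [← hrange, LinearMap.finrank_range_of_inj hφinj, hdim]
    refine ⟨⟨fun hbij hBL ↦ ?_, hinj⟩, fun h ↦ hker (by_contra fun hBL ↦ h (hinj hBL))⟩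
    have h := hker hBL
    rw [LinearMap.ker_eq_bot.2 hbij.1, finrank_bot] at h
    omega
end

section
/- Let Ω ⊆ ℍ be a symmetric slice domain and let f : Ω → ℍ be slice regular and real-differentiable on Ω. Then for every q₀ ∈ Ω ∖ ℝ the real differential Df(q₀) : ℍ → ℍ commutes with left multiplication by I_{q₀}; that is, for all v ∈ ℍ, Df(q₀)(I_{q₀}·v) = I_{q₀}·Df(q₀)(v), where I_{q₀} = Im(q₀)/|Im(q₀)|. -/
open Quaternion

/-- The 2-sphere of imaginary units of `ℍ`. -/
def QSphere : Set ℍ := {q : ℍ | q ^ 2 = -1}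

/-- The slice `L_I = ℝ + ℝ I` of `ℍ`, as a set. -/
def QSlice (I : ℍ) : Set ℍ := {q : ℍ | ∃ x y : ℝ, q = (x : ℍ) + y • I}

/-- `Ω` is a symmetric slice domain: an open connected set meeting the real axis, whose
intersection with each slice `ℝ + ℝ I` is connected, and which is axially symmetric. -/
def IsSymmSliceDomain (Ω : Set ℍ) : Prop :=
  IsOpen Ω ∧ IsConnected Ω ∧ (∃ x : ℝ, (x : ℍ) ∈ Ω) ∧
  (∀ I ∈ QSphere, IsConnected (Ω ∩ QSlice I)) ∧
  (∀ x y : ℝ, ∀ I ∈ QSphere, ∀ J ∈ QSphere, (x : ℍ) + y • I ∈ Ω → (x : ℍ) + y • J ∈ Ω)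

/-- `f` is slice regular on `Ω`: (really) differentiable, and on each slice `ℝ + ℝ I` the
Cauchy–Riemann equation `(∂/∂x + I ∂/∂y) f = 0` holds, i.e. `Df(q) 1 + I · Df(q) I = 0`. -/
def SliceRegularOn (f : ℍ → ℍ) (Ω : Set ℍ) : Prop :=
  (∀ q ∈ Ω, DifferentiableAt ℝ f q) ∧
  ∀ I ∈ QSphere, ∀ q ∈ Ω ∩ QSlice I, fderiv ℝ f q 1 + I * fderiv ℝ f q I = 0

/-- The real-linear embedding `x + iy ↦ x + yI` of `ℂ` in `ℍ`. -/
noncomputable def sliceEmb (I : ℍ) : ℂ →L[ℝ] ℍ :=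
  Complex.reCLM.smulRight (1 : ℍ) + Complex.imCLM.smulRight I

theorem sliceEmb_apply (I : ℍ) (z : ℂ) : sliceEmb I z = (z.re : ℍ) + z.im • I := by
  simp only [sliceEmb, add_apply, ContinuousLinearMap.smulRight_apply,
    Complex.reCLM_apply, Complex.imCLM_apply]
  ext <;> simp

theorem sliceEmb_one (I : ℍ) : sliceEmb I 1 = 1 := by
  simp [sliceEmb_apply]

theorem sliceEmb_I (I : ℍ) : sliceEmb I Complex.I = I := by
  simp [sliceEmb_apply]

theorem mul_self_of_mem_QSphere {I : ℍ} (hI : I ∈ QSphere) : I * I = -1 := by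
  rw [← sq]; exact hI

theorem neg_mem_QSphere {I : ℍ} (hI : I ∈ QSphere) : -I ∈ QSphere := by
  change (-I) ^ 2 = -1
  rw [neg_sq]; exact hI

theorem re_eq_zero_of_mem_QSphere {I : ℍ} (hI : I ∈ QSphere) : I.re = 0 := by
  have h := mul_self_of_mem_QSphere hI
  have h0 := congrArg QuaternionAlgebra.re h
  have h1 := congrArg QuaternionAlgebra.imI h
  have h2 := congrArg QuaternionAlgebra.imJ h
  have h3 := congrArg QuaternionAlgebra.imK h
  simp at h0 h1 h2 h3
  by_contra hne
  have e1 : I.imI = 0 := mul_left_cancel₀ hne (by linarith)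
  have e2 : I.imJ = 0 := mul_left_cancel₀ hne (by linarith)
  have e3 : I.imK = 0 := mul_left_cancel₀ hne (by linarith)
  rw [e1, e2, e3] at h0
  nlinarith

theorem sum_sq_of_mem_QSphere {I : ℍ} (hI : I ∈ QSphere) :
    I.imI ^ 2 + I.imJ ^ 2 + I.imK ^ 2 = 1 := by
  have h0 := congrArg QuaternionAlgebra.re (mul_self_of_mem_QSphere hI)
  have hr := re_eq_zero_of_mem_QSphere hI
  simp [hr] at h0
  nlinarith

theorem sliceEmb_mem_iff {Ω : Set ℍ} (hΩ : IsSymmSliceDomain Ω) {I J : ℍ} (hI : I ∈ QSphere)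
    (hJ : J ∈ QSphere) (z : ℂ) : sliceEmb I z ∈ Ω ↔ sliceEmb J z ∈ Ω := by
  simp only [sliceEmb_apply]
  exact ⟨hΩ.2.2.2.2 _ _ _ hI _ hJ, hΩ.2.2.2.2 _ _ _ hJ _ hI⟩

theorem isPreconnected_sliceEmb_preimage {Ω : Set ℍ} (hΩ : IsSymmSliceDomain Ω) {J : ℍ}
    (hJ : J ∈ QSphere) : IsPreconnected (sliceEmb J ⁻¹' Ω) := by
  have hr := re_eq_zero_of_mem_QSphere hJ
  have hs := sum_sq_of_mem_QSphere hJ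
  have key : ∀ x y : ℝ, (⟨((x : ℍ) + y • J).re, -(((x : ℍ) + y • J) * J).re⟩ : ℂ) = ⟨x, y⟩ := by
    intro x y
    apply Complex.ext
    · simp [hr]
    · simp [hr]
      linear_combination y * hs
  have himg : sliceEmb J ⁻¹' Ω =
      (fun q : ℍ => (q.re : ℂ) + (-(q * J).re : ℝ) * Complex.I) '' (Ω ∩ QSlice J) := by
    ext z
    constructor
    · intro hz
      refine ⟨sliceEmb J z, ⟨hz, z.re, z.im, sliceEmb_apply J z⟩, ?_⟩
      have := key z.re z.im
      simp only [← Complex.mk_eq_add_mul_I, this, sliceEmb_apply]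
    · rintro ⟨q, ⟨hq, x, y, rfl⟩, rfl⟩
      have := key x y
      simp only [← Complex.mk_eq_add_mul_I, this, Set.mem_preimage, sliceEmb_apply]
      exact hq
  rw [himg]
  refine (hΩ.2.2.2.1 J hJ).isPreconnected.image _ (Continuous.continuousOn ?_)
  have h1 : Continuous fun q : ℍ => q.re := Quaternion.continuous_re
  have h2 : Continuous fun q : ℍ => (q * J).re :=
    Quaternion.continuous_re.comp (continuous_id.mul continuous_const)
  fun_prop

theorem SliceRegularOn.hasFDerivAt_comp_sliceEmb {f : ℍ → ℍ} {Ω : Set ℍ}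
    (hf : SliceRegularOn f Ω) (I : ℍ) {z : ℂ} (hz : sliceEmb I z ∈ Ω) :
    HasFDerivAt (fun w => f (sliceEmb I w))
      ((fderiv ℝ f (sliceEmb I z)).comp (sliceEmb I)) z :=
  (hf.1 _ hz).hasFDerivAt.comp z (sliceEmb I).hasFDerivAt

theorem SliceRegularOn.fderiv_unit {f : ℍ → ℍ} {Ω : Set ℍ}
    (hf : SliceRegularOn f Ω) {I : ℍ} (hI : I ∈ QSphere) {z : ℂ} (hz : sliceEmb I z ∈ Ω) :
    fderiv ℝ f (sliceEmb I z) I = I * fderiv ℝ f (sliceEmb I z) 1 := by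
  have h := hf.2 I hI _ ⟨hz, z.re, z.im, sliceEmb_apply I z⟩
  rw [eq_neg_of_add_eq_zero_left h, mul_neg, ← mul_assoc, mul_self_of_mem_QSphere hI]
  simp

/-- A real-linear map `ℍ → ℂ` which intertwines left multiplication by `J` and `i`. -/
noncomputable def sliceFunctional (J p : ℍ) : ℍ →L[ℝ] ℂ :=
  LinearMap.toContinuousLinearMap
    { toFun := fun q => ⟨(p * q).re, -(p * (J * q)).re⟩
      map_add' := by
        intro a b
        apply Complex.ext
        · simp only [mul_add, Complex.add_re, Quaternion.re_add]
        · simp only [mul_add, Complex.add_im, Quaternion.re_add]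
          ring
      map_smul' := by
        intro a b
        apply Complex.ext
        · simp only [mul_smul_comm, Quaternion.re_smul, RingHom.id_apply, Complex.smul_re]
        · simp only [mul_smul_comm, Quaternion.re_smul, RingHom.id_apply, Complex.smul_im,
            smul_neg] }

theorem sliceFunctional_apply (J p q : ℍ) :
    sliceFunctional J p q = ⟨(p * q).re, -(p * (J * q)).re⟩ := rfl

theorem sliceFunctional_mul {J : ℍ} (hJ : J ∈ QSphere) (p q : ℍ) :
    sliceFunctional J p (J * q) = Complex.I * sliceFunctional J p q := by
  have h : J * (J * q) = -q := by rw [← mul_assoc, mul_self_of_mem_QSphere hJ]; simp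
  rw [sliceFunctional_apply, sliceFunctional_apply, h]
  apply Complex.ext
  · simp only [Complex.mul_re, Complex.I_re, Complex.I_im]; ring
  · simp only [Complex.mul_im, Complex.I_re, Complex.I_im, mul_neg, Quaternion.re_neg]; ring

theorem eq_zero_of_sliceFunctional {J q : ℍ} (h : ∀ p, sliceFunctional J p q = 0) : q = 0 := by
  have h1 := congrArg Complex.re (h (star q))
  rw [sliceFunctional_apply] at h1
  rw [Quaternion.star_mul_self] at h1
  simpa using h1

/-- Identity principle for functions `ℂ → ℍ` which are holomorphic with respect to the complex
structure on `ℍ` given by left multiplication by `J`. -/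
theorem eqOn_zero_of_cauchyRiemann {J : ℍ} (hJ : J ∈ QSphere) {U : Set ℂ} (hU : IsOpen U)
    (hUc : IsPreconnected U) {h : ℂ → ℍ} (hd : ∀ z ∈ U, DifferentiableAt ℝ h z)
    (hCR : ∀ z ∈ U, fderiv ℝ h z Complex.I = J * fderiv ℝ h z 1) {x : ℝ} (hx : (x : ℂ) ∈ U)
    (hreal : ∀ t : ℝ, h t = 0) : ∀ z ∈ U, h z = 0 := by
  intro z hz
  refine eq_zero_of_sliceFunctional (J := J) fun p => ?_
  have hdiff : DifferentiableOn ℂ (fun w => sliceFunctional J p (h w)) U := by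
    intro w hw
    apply DifferentiableAt.differentiableWithinAt
    rw [differentiableAt_complex_iff_differentiableAt_real]
    have hc : HasFDerivAt (fun w => sliceFunctional J p (h w))
        ((sliceFunctional J p).comp (fderiv ℝ h w)) w :=
      (sliceFunctional J p).hasFDerivAt.comp w (hd w hw).hasFDerivAt
    refine ⟨hc.differentiableAt, ?_⟩
    rw [hc.fderiv]
    simp only [ContinuousLinearMap.comp_apply, hCR w hw, sliceFunctional_mul hJ, smul_eq_mul]
  have hfreq : ∃ᶠ w in nhdsWithin (x : ℂ) {(x : ℂ)}ᶜ, sliceFunctional J p (h w) = 0 := by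
    have ht : Filter.Tendsto (fun t : ℝ => (t : ℂ)) (nhdsWithin x {x}ᶜ)
        (nhdsWithin (x : ℂ) {(x : ℂ)}ᶜ) := by
      refine Complex.continuous_ofReal.continuousWithinAt.tendsto_nhdsWithin ?_
      intro t ht
      simpa using ht
    refine ht.frequently (Filter.Eventually.frequently (Filter.Eventually.of_forall fun t => ?_))
    simp [hreal t]
  exact (hdiff.analyticOnNhd hU).eqOn_zero_of_preconnected_of_frequently_eq_zero hUc hx hfreq hz

/-- The representation formula for slice regular functions on symmetric slice domains. -/
theorem SliceRegularOn.representation {f : ℍ → ℍ} {Ω : Set ℍ} (hΩ : IsSymmSliceDomain Ω)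
    (hf : SliceRegularOn f Ω) {I J : ℍ} (hI : I ∈ QSphere) (hJ : J ∈ QSphere) {z : ℂ}
    (hz : sliceEmb J z ∈ Ω) :
    f (sliceEmb J z) = (2⁻¹ : ℝ) • (f (sliceEmb I z) + f (sliceEmb (-I) z)) +
      J * ((2⁻¹ : ℝ) • (I * (f (sliceEmb (-I) z) - f (sliceEmb I z)))) := by
  have hI' := neg_mem_QSphere hI
  obtain ⟨x, hx⟩ := hΩ.2.2.1
  set h : ℂ → ℍ := fun w => f (sliceEmb J w) -
    ((2⁻¹ : ℝ) • (f (sliceEmb I w) + f (sliceEmb (-I) w)) +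
      J * ((2⁻¹ : ℝ) • (I * (f (sliceEmb (-I) w) - f (sliceEmb I w))))) with hh
  have hder : ∀ w ∈ sliceEmb J ⁻¹' Ω, ∃ D : ℂ →L[ℝ] ℍ, HasFDerivAt h D w ∧
      D Complex.I = J * D 1 := by
    intro w hw
    have hwI := (sliceEmb_mem_iff hΩ hJ hI w).1 hw
    have hwI' := (sliceEmb_mem_iff hΩ hJ hI' w).1 hw
    have dJ := hf.hasFDerivAt_comp_sliceEmb J hw
    have dI := hf.hasFDerivAt_comp_sliceEmb I hwI
    have dI' := hf.hasFDerivAt_comp_sliceEmb (-I) hwI'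
    refine ⟨_, dJ.sub (((dI.add dI').const_smul (2⁻¹ : ℝ)).add
      ((((dI'.sub dI).const_mul I).const_smul (2⁻¹ : ℝ)).const_mul J)), ?_⟩
    simp only [sub_apply, add_apply,
      smul_apply, ContinuousLinearMap.comp_apply, sliceEmb_one, sliceEmb_I,
      hf.fderiv_unit hJ hw, hf.fderiv_unit hI hwI, hf.fderiv_unit hI' hwI', smul_eq_mul]
    generalize fderiv ℝ f (sliceEmb J w) 1 = C
    generalize fderiv ℝ f (sliceEmb I w) 1 = A
    generalize fderiv ℝ f (sliceEmb (-I) w) 1 = B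
    have eI : ∀ q, I * (I * q) = -q := fun q => by
      rw [← mul_assoc, mul_self_of_mem_QSphere hI]; simp
    have eJ : ∀ q, J * (J * q) = -q := fun q => by
      rw [← mul_assoc, mul_self_of_mem_QSphere hJ]; simp
    simp only [mul_sub, mul_add, mul_smul_comm, neg_mul, mul_neg, eI, eJ, smul_add, smul_sub,
      smul_neg]
    abel
  have h0 := eqOn_zero_of_cauchyRiemann hJ (hΩ.1.preimage (sliceEmb J).continuous)
    (isPreconnected_sliceEmb_preimage hΩ hJ) (h := h)
    (fun w hw => by obtain ⟨D, hD, -⟩ := hder w hw; exact hD.differentiableAt)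
    (fun w hw => by obtain ⟨D, hD, e⟩ := hder w hw; rw [hD.fderiv, e])
    (x := x) (by simpa [sliceEmb_apply] using hx)
    (fun t => by
      simp only [hh, sliceEmb_apply, Complex.ofReal_re, Complex.ofReal_im, zero_smul, add_zero,
        sub_self, mul_zero, smul_zero]
      rw [← two_smul ℝ (f t), smul_smul]
      norm_num) z hz
  exact sub_eq_zero.1 h0

theorem cos_smul_add_sin_smul_mem_QSphere {I K : ℍ} (hI : I ∈ QSphere) (hK : K ∈ QSphere)
    (hIK : I * K + K * I = 0) (t : ℝ) : Real.cos t • I + Real.sin t • K ∈ QSphere := by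
  change (Real.cos t • I + Real.sin t • K) ^ 2 = -1
  have e : (Real.cos t • I + Real.sin t • K) ^ 2 = (Real.cos t ^ 2) • (I * I) +
      (Real.sin t ^ 2) • (K * K) + (Real.cos t * Real.sin t) • (I * K + K * I) := by
    simp only [sq, mul_add, add_mul, smul_mul_smul_comm, smul_add, mul_comm (Real.sin t)]
    abel
  rw [e, hIK, mul_self_of_mem_QSphere hI, mul_self_of_mem_QSphere hK, smul_zero, add_zero,
    ← add_smul, Real.cos_sq_add_sin_sq, one_smul]

/-- The differential of a slice regular function in the directions tangent to the sphere
`x + y𝕊` is right multiplication by a fixed quaternion. -/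
theorem SliceRegularOn.exists_fderiv_eq_mul {f : ℍ → ℍ} {Ω : Set ℍ} (hΩ : IsSymmSliceDomain Ω)
    (hf : SliceRegularOn f Ω) {I : ℍ} (hI : I ∈ QSphere) {z : ℂ} (hz : sliceEmb I z ∈ Ω)
    (hz0 : z.im ≠ 0) :
    ∃ b : ℍ, ∀ w : ℍ, w.re = 0 → I * w + w * I = 0 →
      fderiv ℝ f (sliceEmb I z) w = w * b := by
  set b : ℍ := (2⁻¹ : ℝ) • (I * (f (sliceEmb (-I) z) - f (sliceEmb I z))) with hb
  set a : ℍ := (2⁻¹ : ℝ) • (f (sliceEmb I z) + f (sliceEmb (-I) z)) with ha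
  have unit : ∀ K ∈ QSphere, I * K + K * I = 0 →
      z.im • fderiv ℝ f (sliceEmb I z) K = K * b := by
    intro K hK hIK
    set γ : ℝ → ℍ := fun t => Real.cos t • I + Real.sin t • K with hγ
    have hγ0 : γ 0 = I := by simp [hγ]
    have dγ : HasDerivAt γ K 0 := by
      have h : HasDerivAt γ (-Real.sin 0 • I + Real.cos 0 • K) 0 :=
        ((Real.hasDerivAt_cos 0).smul_const I).add ((Real.hasDerivAt_sin 0).smul_const K)
      simpa only [Real.sin_zero, Real.cos_zero, neg_zero, zero_smul, one_smul, zero_add] using h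
    have dc : HasDerivAt (fun t => (z.re : ℍ) + z.im • γ t) (z.im • K) 0 :=
      (dγ.const_smul z.im).const_add _
    have hpt : (z.re : ℍ) + z.im • γ 0 = sliceEmb I z := by rw [hγ0, sliceEmb_apply]
    have d1 : HasDerivAt (fun t => f ((z.re : ℍ) + z.im • γ t))
        (fderiv ℝ f (sliceEmb I z) (z.im • K)) 0 := by
      have hfd := (hf.1 _ hz).hasFDerivAt
      rw [← hpt] at hfd ⊢
      exact hfd.comp_hasDerivAt 0 dc
    have heq : (fun t => f ((z.re : ℍ) + z.im • γ t)) = fun t => a + γ t * b := by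
      funext t
      have hJ := cos_smul_add_sin_smul_mem_QSphere hI hK hIK t
      have := hf.representation hΩ hI hJ ((sliceEmb_mem_iff hΩ hI hJ z).1 hz)
      rw [sliceEmb_apply (Real.cos t • I + Real.sin t • K)] at this
      exact this
    have d2 : HasDerivAt (fun t => a + γ t * b) (K * b) 0 := (dγ.mul_const b).const_add a
    rw [heq] at d1
    rw [← map_smul]
    exact d1.unique d2
  refine ⟨z.im⁻¹ • b, fun w hw hIw => ?_⟩
  rcases eq_or_ne w 0 with rfl | hne
  · simp
  have hn : ‖w‖ ≠ 0 := norm_ne_zero_iff.2 hne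
  have hww : w * w = -((‖w‖ ^ 2 : ℝ) : ℍ) := by
    have hs : star w = -w := Quaternion.star_eq_neg.2 hw
    have := Quaternion.self_mul_star w
    rw [hs, Quaternion.normSq_eq_norm_mul_self, ← sq] at this
    rw [← this]; simp
  have hK : ‖w‖⁻¹ • w ∈ QSphere := by
    change (‖w‖⁻¹ • w) ^ 2 = -1
    rw [smul_pow, sq w, hww, smul_neg, ← Quaternion.coe_smul]
    rw [smul_eq_mul, ← mul_pow, inv_mul_cancel₀ hn]
    simp
  have h := unit _ hK (by rw [mul_smul_comm, smul_mul_assoc, ← smul_add, hIw, smul_zero])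
  rw [map_smul, smul_mul_assoc, smul_comm] at h
  have h' := smul_right_injective ℍ (inv_ne_zero hn) h
  rw [mul_smul_comm, ← h']
  simp only [smul_smul, inv_mul_cancel₀ hz0, one_smul]

theorem exists_slice_decomposition {I : ℍ} (hI : I ∈ QSphere) (v : ℍ) :
    ∃ (α β : ℝ) (w : ℍ), v = α • (1 : ℍ) + β • I + w ∧ w.re = 0 ∧ I * w + w * I = 0 := by
  have hr := re_eq_zero_of_mem_QSphere hI
  have hs := sum_sq_of_mem_QSphere hI
  refine ⟨v.re, -(v * I).re, v - (v.re • (1 : ℍ) + (-(v * I).re) • I), by abel, by simp [hr], ?_⟩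
  ext
  · simp [hr]
    linear_combination (2 * (v.imI * I.imI + v.imJ * I.imJ + v.imK * I.imK)) * hs
  all_goals
    simp [hr]
    ring

theorem inv_norm_smul_im_mem_QSphere {q : ℍ} (hq : q.im ≠ 0) : ‖q.im‖⁻¹ • q.im ∈ QSphere := by
  have hn : ‖q.im‖ ≠ 0 := norm_ne_zero_iff.2 hq
  change (‖q.im‖⁻¹ • q.im) ^ 2 = -1
  rw [smul_pow, Quaternion.im_sq, Quaternion.normSq_eq_norm_mul_self, ← sq, smul_neg,
    ← Quaternion.coe_smul, smul_eq_mul, ← mul_pow, inv_mul_cancel₀ hn]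
  simp

/-- If `f` is slice regular (and real-differentiable) on a symmetric slice
domain `Ω`, then at every non-real `q₀ ∈ Ω` the real differential of `f` commutes with left
multiplication by `I_{q₀} = Im q₀ / |Im q₀|`. -/
theorem statement2 (Ω : Set ℍ) (hΩ : IsSymmSliceDomain Ω) (f : ℍ → ℍ)
    (hf : SliceRegularOn f Ω) :
    ∀ q₀ ∈ Ω, q₀.im ≠ 0 → ∀ v : ℍ,
      fderiv ℝ f q₀ ((‖q₀.im‖⁻¹ • q₀.im) * v) =
        (‖q₀.im‖⁻¹ • q₀.im) * fderiv ℝ f q₀ v := by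
  intro q₀ hq₀ him v
  set I : ℍ := ‖q₀.im‖⁻¹ • q₀.im with hIdef
  have hI : I ∈ QSphere := inv_norm_smul_im_mem_QSphere him
  have hn : ‖q₀.im‖ ≠ 0 := norm_ne_zero_iff.2 him
  have hpt : sliceEmb I ⟨q₀.re, ‖q₀.im‖⟩ = q₀ := by
    rw [sliceEmb_apply, hIdef, smul_smul, mul_inv_cancel₀ hn, one_smul]
    exact Quaternion.re_add_im q₀
  have hz : sliceEmb I ⟨q₀.re, ‖q₀.im‖⟩ ∈ Ω := by rwa [hpt]
  obtain ⟨b, hb⟩ := hf.exists_fderiv_eq_mul hΩ hI hz hn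
  have hu := hf.fderiv_unit hI hz
  rw [hpt] at hb hu
  have hII := mul_self_of_mem_QSphere hI
  obtain ⟨α, β, w, rfl, hw, hIw⟩ := exists_slice_decomposition hI v
  have hwI : w * I = -(I * w) := eq_neg_of_add_eq_zero_right hIw
  have hIwre : (I * w).re = 0 := by
    have h1 := congrArg QuaternionAlgebra.re hIw
    simp at h1 ⊢
    linarith
  have hIIw : I * (I * w) + I * w * I = 0 := by
    rw [mul_assoc I w I, hwI, mul_neg, add_neg_cancel]
  simp only [mul_add, mul_smul_comm, mul_one, map_add, map_smul, hII, map_neg, hu, hb w hw hIw,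
    hb _ hIwre hIIw]
  rw [← mul_assoc I I, hII, mul_assoc]
  simp
end

section
/- Let a, b, c, d ∈ ℍ satisfy the invertibility condition |a|²|d|² + |b|²|c|² − 2·Re(conj(b)·d·conj(c)·a) ≠ 0. If the three quaternions conj(c)·a, conj(d)·a + conj(c)·b, and conj(d)·b are all real, then there exist a unit quaternion ε ∈ ℍ with |ε| = 1 and real numbers α, β, γ, δ such that a = αε, b = βε, c = γε and d = δε. (Consequently, the subgroup of linear fractional transformations q ↦ (qc+d)⁻¹(qa+b) preserving the complex structure 𝕁 consists exactly of those with a, b, c, d real multiples of a common unit quaternion.) -/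
open Quaternion

/-- If `conj p · q` is real and `p ≠ 0`, then `q` is a real multiple of `p`. -/
lemma Quaternion.exists_eq_smul_of_star_mul_eq_coe {p q : ℍ} (hp : p ≠ 0) {r : ℝ}
    (h : star p * q = (r : ℍ)) : ∃ t : ℝ, q = t • p := by
  have hn : Quaternion.normSq p ≠ 0 := Quaternion.normSq_ne_zero.mpr hp
  refine ⟨(Quaternion.normSq p)⁻¹ * r, ?_⟩
  have key : Quaternion.normSq p • q = r • p := by
    rw [← Quaternion.coe_mul_eq_smul, ← Quaternion.self_mul_star, mul_assoc, h,
      Quaternion.mul_coe_eq_smul]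
  rw [mul_smul, ← key, smul_smul, inv_mul_cancel₀ hn, one_smul]

/-- A nonzero quaternion is a real multiple of a unit quaternion, and so are its real multiples. -/
lemma Quaternion.exists_norm_eq_one_smul {p : ℍ} (hp : p ≠ 0) :
    ∃ ε : ℍ, ‖ε‖ = 1 ∧ ∀ t : ℝ, t • p = (t * ‖p‖) • ε := by
  have hn : ‖p‖ ≠ 0 := norm_ne_zero_iff.mpr hp
  refine ⟨‖p‖⁻¹ • p, by rw [norm_smul, norm_inv, norm_norm, inv_mul_cancel₀ hn], fun t => ?_⟩
  rw [smul_smul, mul_assoc, mul_inv_cancel₀ hn, mul_one]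

/-- If `s · conj q · p + t · conj p · q` is real with `s ≠ t`, then `conj p · q` is real. -/
lemma Quaternion.star_mul_eq_coe_of_smul_add_smul {p q : ℍ} {s t r : ℝ} (hst : s ≠ t)
    (h : star q * (s • p) + star p * (t • q) = (r : ℍ)) :
    ∃ u : ℝ, star p * q = (u : ℍ) := by
  have hts : t - s ≠ 0 := sub_ne_zero.mpr hst.symm
  refine ⟨(star p * q).re, ?_⟩
  have hI := congrArg QuaternionAlgebra.imI h
  have hJ := congrArg QuaternionAlgebra.imJ h
  have hK := congrArg QuaternionAlgebra.imK h
  simp at hI hJ hK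
  ext
  · simp
  · apply mul_left_cancel₀ hts
    simp [-mul_eq_zero]
    linear_combination hI
  · apply mul_left_cancel₀ hts
    simp [-mul_eq_zero]
    linear_combination hJ
  · apply mul_left_cancel₀ hts
    simp [-mul_eq_zero]
    linear_combination hK

/-- If `a, b, c, d ∈ ℍ` satisfy the invertibility condition
`|a|²|d|² + |b|²|c|² - 2 Re(conj b · d · conj c · a) ≠ 0` and the three quaternions
`conj c · a`, `conj d · a + conj c · b`, `conj d · b` are all real, then `a, b, c, d`
are real multiples of a common unit quaternion `ε`. -/
theorem statement3 (a b c d : ℍ)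
    (hinv : ‖a‖ ^ 2 * ‖d‖ ^ 2 + ‖b‖ ^ 2 * ‖c‖ ^ 2
      - 2 * (star b * d * (star c * a)).re ≠ 0)
    (h1 : ∃ r : ℝ, star c * a = (r : ℍ))
    (h2 : ∃ r : ℝ, star d * a + star c * b = (r : ℍ))
    (h3 : ∃ r : ℝ, star d * b = (r : ℍ)) :
    ∃ ε : ℍ, ‖ε‖ = 1 ∧ ∃ α β γ δ : ℝ,
      a = α • ε ∧ b = β • ε ∧ c = γ • ε ∧ d = δ • ε := by
  suffices h : ∃ p : ℍ, p ≠ 0 ∧ ∃ α β γ δ : ℝ,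
      a = α • p ∧ b = β • p ∧ c = γ • p ∧ d = δ • p by
    obtain ⟨p, hp, α, β, γ, δ, ha, hb, hc, hd⟩ := h
    obtain ⟨ε, hε, hs⟩ := Quaternion.exists_norm_eq_one_smul hp
    exact ⟨ε, hε, _, _, _, _, ha.trans (hs _), hb.trans (hs _), hc.trans (hs _),
      hd.trans (hs _)⟩
  obtain ⟨r₁, h1⟩ := h1
  obtain ⟨r₂, h2⟩ := h2
  obtain ⟨r₃, h3⟩ := h3
  rcases eq_or_ne c 0 with rfl | hc
  · have hd : d ≠ 0 := by
      rintro rfl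
      simp at hinv
    obtain ⟨α, ha⟩ := Quaternion.exists_eq_smul_of_star_mul_eq_coe hd (by simpa using h2)
    obtain ⟨β, hb⟩ := Quaternion.exists_eq_smul_of_star_mul_eq_coe hd h3
    exact ⟨d, hd, α, β, 0, 1, ha, hb, (zero_smul _ _).symm, (one_smul _ _).symm⟩
  obtain ⟨α, ha⟩ := Quaternion.exists_eq_smul_of_star_mul_eq_coe hc h1
  rcases eq_or_ne d 0 with rfl | hd
  · obtain ⟨β, hb⟩ := Quaternion.exists_eq_smul_of_star_mul_eq_coe hc (by simpa using h2)
    exact ⟨c, hc, α, β, 1, 0, ha, hb, (one_smul _ _).symm, (zero_smul _ _).symm⟩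
  obtain ⟨β, hb⟩ := Quaternion.exists_eq_smul_of_star_mul_eq_coe hd h3
  subst ha hb
  have hαβ : α ≠ β := by
    rintro rfl
    apply hinv
    simp only [pow_two, ← Quaternion.normSq_eq_norm_mul_self, Quaternion.normSq_def']
    simp
    ring
  obtain ⟨u, hu⟩ := Quaternion.star_mul_eq_coe_of_smul_add_smul hαβ h2
  obtain ⟨δ, hδ⟩ := Quaternion.exists_eq_smul_of_star_mul_eq_coe hc hu
  exact ⟨c, hc, α, β * δ, 1, δ, rfl, by rw [hδ, smul_smul], (one_smul _ _).symm, hδ⟩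
end

section
/- Let ℂ⁺ = {x+iy ∈ ℂ : y > 0} and embed ℂ ⊂ ℍ as ℝ+ℝi. The map φ : ℂ × ℂ⁺ → ℍ defined by φ(u,v) = (1+uj)⁻¹·v·(1+uj) is injective, and its image is exactly ℍ ∖ {x + ti : x ∈ ℝ, t ≤ 0}. (This is the underlying parametrization in the biholomorphism between (ℍ∖ℝ, 𝕁) and an open subset of the quadric Z₀Z₃ = Z₁Z₂ in ℂP³.) -/
open Quaternion

/-- The quaternion `j`. -/
def qj : ℍ := ⟨0, 0, 1, 0⟩

/-- The map `φ(u,v) = (1 + uj)⁻¹ · v · (1 + uj)`, with `ℂ ⊂ ℍ` as `ℝ + ℝi`. -/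
noncomputable def phiMap (p : ℂ × ℂ) : ℍ :=
  (1 + (p.1 : ℍ) * qj)⁻¹ * (p.2 : ℍ) * (1 + (p.1 : ℍ) * qj)

theorem qj_re : qj.re = 0 := rfl

theorem qj_imI : qj.imI = 0 := rfl

theorem qj_imJ : qj.imJ = 1 := rfl

theorem qj_imK : qj.imK = 0 := rfl

theorem one_add_mul_qj_ne_zero (u : ℂ) : 1 + (u : ℍ) * qj ≠ 0 := by
  intro h
  have hre := congrArg QuaternionAlgebra.re h
  simp [qj_re, qj_imI, qj_imJ, qj_imK] at hre

/-- The coordinates of `φ(u,v)` characterize it. -/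
theorem phiMap_eq_of_coords {u v : ℂ} {q : ℍ} (hre : q.re = v.re)
    (hI : q.imI = v.im * (1 - u.re ^ 2 - u.im ^ 2) / (1 + u.re ^ 2 + u.im ^ 2))
    (hJ : q.imJ = -(2 * u.im * v.im) / (1 + u.re ^ 2 + u.im ^ 2))
    (hK : q.imK = 2 * u.re * v.im / (1 + u.re ^ 2 + u.im ^ 2)) :
    phiMap (u, v) = q := by
  have hN : 1 + u.re ^ 2 + u.im ^ 2 ≠ 0 := by positivity
  have key : (v : ℍ) * (1 + (u : ℍ) * qj) = (1 + (u : ℍ) * qj) * q := by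
    ext <;> simp [qj_re, qj_imI, qj_imJ, qj_imK, hre, hI, hJ, hK] <;> field_simp <;> ring
  change (1 + (u : ℍ) * qj)⁻¹ * (v : ℍ) * (1 + (u : ℍ) * qj) = q
  rw [mul_assoc, key, inv_mul_cancel_left₀ (one_add_mul_qj_ne_zero u)]

/-- Explicit coordinates of `φ(u,v)`. -/
theorem phiMap_coords (u v : ℂ) :
    (phiMap (u, v)).re = v.re ∧
    (phiMap (u, v)).imI = v.im * (1 - u.re ^ 2 - u.im ^ 2) / (1 + u.re ^ 2 + u.im ^ 2) ∧
    (phiMap (u, v)).imJ = -(2 * u.im * v.im) / (1 + u.re ^ 2 + u.im ^ 2) ∧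
    (phiMap (u, v)).imK = 2 * u.re * v.im / (1 + u.re ^ 2 + u.im ^ 2) := by
  obtain ⟨q, hre, hI, hJ, hK⟩ : ∃ q : ℍ, q.re = v.re ∧
      q.imI = v.im * (1 - u.re ^ 2 - u.im ^ 2) / (1 + u.re ^ 2 + u.im ^ 2) ∧
      q.imJ = -(2 * u.im * v.im) / (1 + u.re ^ 2 + u.im ^ 2) ∧
      q.imK = 2 * u.re * v.im / (1 + u.re ^ 2 + u.im ^ 2) :=
    ⟨⟨_, _, _, _⟩, rfl, rfl, rfl, rfl⟩
  rw [phiMap_eq_of_coords hre hI hJ hK]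
  exact ⟨hre, hI, hJ, hK⟩

/-- The imaginary part of `v` is the norm of the imaginary part of `φ(u,v)`. -/
theorem phiMap_im_sq (u v : ℂ) :
    (phiMap (u, v)).imI ^ 2 + (phiMap (u, v)).imJ ^ 2 + (phiMap (u, v)).imK ^ 2 = v.im ^ 2 := by
  have hN : 1 + u.re ^ 2 + u.im ^ 2 ≠ 0 := by positivity
  obtain ⟨-, hI, hJ, hK⟩ := phiMap_coords u v
  rw [hI, hJ, hK]
  field_simp
  ring

theorem phiMap_imI_add (u v : ℂ) :
    (phiMap (u, v)).imI + v.im = 2 * v.im / (1 + u.re ^ 2 + u.im ^ 2) := by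
  have hN : 1 + u.re ^ 2 + u.im ^ 2 ≠ 0 := by positivity
  rw [(phiMap_coords u v).2.1]
  field_simp
  ring

theorem phiMap_imJ (u v : ℂ) :
    (phiMap (u, v)).imJ = -u.im * ((phiMap (u, v)).imI + v.im) := by
  rw [phiMap_imI_add, (phiMap_coords u v).2.2.1]
  ring

theorem phiMap_imK (u v : ℂ) :
    (phiMap (u, v)).imK = u.re * ((phiMap (u, v)).imI + v.im) := by
  rw [phiMap_imI_add, (phiMap_coords u v).2.2.2]
  ring

theorem phiMap_imI_add_pos (u : ℂ) {v : ℂ} (hv : 0 < v.im) :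
    0 < (phiMap (u, v)).imI + v.im := by
  rw [phiMap_imI_add]
  positivity

/-- The map `φ : ℂ × ℂ⁺ → ℍ`, `φ(u,v) = (1+uj)⁻¹ v (1+uj)`, is injective
and its image is exactly `ℍ ∖ {x + ti : x ∈ ℝ, t ≤ 0}`. -/
theorem statement4 :
    Set.InjOn phiMap {p : ℂ × ℂ | 0 < p.2.im} ∧
    phiMap '' {p : ℂ × ℂ | 0 < p.2.im} =
      {q : ℍ | ¬(q.imJ = 0 ∧ q.imK = 0 ∧ q.imI ≤ 0)} := by
  refine ⟨?_, Set.Subset.antisymm ?_ ?_⟩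
  · rintro ⟨u, v⟩ hv ⟨u', v'⟩ hv' h
    simp only [Set.mem_ofPred_eq] at hv hv'
    have hre : v.re = v'.re := by
      rw [← (phiMap_coords u v).1, h, (phiMap_coords u' v').1]
    have him : v.im = v'.im := by
      have h1 := phiMap_im_sq u v
      rw [h, phiMap_im_sq u' v'] at h1
      exact ((sq_eq_sq₀ hv'.le hv.le).1 h1).symm
    have hpos := phiMap_imI_add_pos u' hv'
    have hJ := phiMap_imJ u v
    have hK := phiMap_imK u v
    rw [h, him] at hJ hK
    rw [phiMap_imJ u' v'] at hJ
    rw [phiMap_imK u' v'] at hK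
    have hJ' := mul_right_cancel₀ hpos.ne' hJ
    have hK' := mul_right_cancel₀ hpos.ne' hK
    exact Prod.ext (Complex.ext hK'.symm (by simpa using hJ'.symm)) (Complex.ext hre him)
  · rintro _ ⟨⟨u, v⟩, hv, rfl⟩ ⟨hJ, hK, hI⟩
    simp only [Set.mem_ofPred_eq] at hv
    have hpos := phiMap_imI_add_pos u hv
    have hsq := phiMap_im_sq u v
    rw [hJ, hK] at hsq
    nlinarith
  · intro q hq
    replace hq : ¬(q.imJ = 0 ∧ q.imK = 0 ∧ q.imI ≤ 0) := hq
    generalize hb : q.imI = b at hq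
    generalize hc : q.imJ = c at hq
    generalize hd : q.imK = d at hq
    set r := √(b ^ 2 + c ^ 2 + d ^ 2) with hr
    have hr0 : 0 ≤ r := Real.sqrt_nonneg _
    have hr2 : r ^ 2 = b ^ 2 + c ^ 2 + d ^ 2 := Real.sq_sqrt (by positivity)
    have hs : 0 < b + r := by
      by_contra! hle
      have hb : b ^ 2 ≥ r ^ 2 := by nlinarith
      refine hq ⟨?_, ?_, by linarith⟩ <;> nlinarith [sq_nonneg c, sq_nonneg d]
    have hrpos : 0 < r := by
      by_contra! hle
      nlinarith [sq_nonneg c, sq_nonneg d]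
    have hN : 1 + (d / (b + r)) ^ 2 + (-c / (b + r)) ^ 2 = 2 * r / (b + r) := by
      field_simp
      linear_combination -hr2
    have hM : 1 - (d / (b + r)) ^ 2 - (-c / (b + r)) ^ 2 = 2 * b / (b + r) := by
      linear_combination -hN - (by field_simp : 2 * (b + r) / (b + r) = 2)
    refine ⟨(⟨d / (b + r), -c / (b + r)⟩, ⟨q.re, r⟩), hrpos, phiMap_eq_of_coords rfl ?_ ?_ ?_⟩
    · rw [hb, hN, hM]
      field_simp
    · rw [hc, hN]
      field_simp
    · rw [hd, hN]
      field_simp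
end

section
/- Let f : ℍ → ℍ be given by f(q) = q² + qi. For every α ∈ ℍ, the quaternion α + conj(α) − i is nonzero, and setting r = (α + conj(α) − i)·(−α − i)·(α + conj(α) − i)⁻¹, the fibre of f through α is exactly {q ∈ ℍ : q² + qi = α² + αi} = {α, r}. -/
open Quaternion

/-- The quaternion `i`. -/
def qi : ℍ := ⟨0, 1, 0, 0⟩

theorem qi_imI : qi.imI = 1 := rfl

theorem Quaternion.re_mul_comm (a b : ℍ) : (a * b).re = (b * a).re := by
  simp only [Quaternion.re_mul]
  ring

theorem Quaternion.re_eq_of_mul_eq_mul_s8 {u p q : ℍ} (hu : u ≠ 0) (h : q * u = u * p) :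
    q.re = p.re := by
  have hq : q = u * p * u⁻¹ := by rw [← h, mul_assoc, mul_inv_cancel₀ hu, mul_one]
  rw [hq, Quaternion.re_mul_comm, ← mul_assoc, inv_mul_cancel₀ hu, one_mul]

theorem Quaternion.normSq_eq_of_mul_eq_mul_s8 {u p q : ℍ} (hu : u ≠ 0) (h : q * u = u * p) :
    normSq q = normSq p := by
  have hn := congrArg normSq h
  rw [map_mul, map_mul, mul_comm] at hn
  exact mul_left_cancel₀ (Quaternion.normSq_ne_zero.2 hu) hn

/-- If `q` and `p` are conjugate, then `q` is a root of `(X - a) * (X - p)`, with coefficients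
on the right, exactly when `a - star p` intertwines `q` and `p`. -/
theorem Quaternion.mul_sub_star_sub_eq {u p q : ℍ} (hu : u ≠ 0) (h : q * u = u * p) (a : ℍ) :
    q * (a - star p) - (a - star p) * p = -(q ^ 2 - q * (a + p) + a * p) := by
  have hs : q + star q = p + star p := by
    rw [Quaternion.self_add_star, Quaternion.self_add_star,
      Quaternion.re_eq_of_mul_eq_mul_s8 hu h]
  have hn : q * star q = star p * p := by
    rw [Quaternion.self_mul_star, Quaternion.star_mul_self,
      Quaternion.normSq_eq_of_mul_eq_mul_s8 hu h]
  have hp : star p = q + star q - p := by rw [hs]; abel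
  rw [sub_mul, ← hn, hp]
  noncomm_ring

/-- For `f(q) = q² + qi` and any `α ∈ ℍ`, the quaternion
`α + conj α - i` is nonzero, and the fibre of `f` through `α` is exactly
`{α, (α + conj α - i)(-α - i)(α + conj α - i)⁻¹}`. -/
theorem statement8 (α : ℍ) :
    α + star α - qi ≠ 0 ∧
    {q : ℍ | q ^ 2 + q * qi = α ^ 2 + α * qi} =
      {α, (α + star α - qi) * (-α - qi) * (α + star α - qi)⁻¹} := by
  have hd : α + star α - qi ≠ 0 := fun h => by
    have := congrArg (fun q : ℍ => q.imI) h
    simp [qi_imI] at this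
  have hstar : star qi = -qi := Quaternion.star_eq_neg.2 rfl
  have hdp : α + star α - qi = α - star (-α - qi) := by
    rw [star_sub, star_neg, hstar]
    abel
  have key (q u : ℍ) (hu : u ≠ 0) (h : q * u = u * (-α - qi)) :
      q * (α + star α - qi) - (α + star α - qi) * (-α - qi) =
        -(q ^ 2 + q * qi - (α ^ 2 + α * qi)) := by
    rw [hdp, Quaternion.mul_sub_star_sub_eq hu h]
    noncomm_ring
  refine ⟨hd, Set.ext fun q => ?_⟩
  simp only [Set.mem_ofPred_eq, Set.mem_insert_iff, Set.mem_singleton_iff]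
  rw [eq_mul_inv_iff_mul_eq₀ hd]
  constructor
  · intro hq
    refine or_iff_not_imp_left.2 fun hne => ?_
    have hu : q * (q - α) = (q - α) * (-α - qi) := by
      rw [← sub_eq_zero] at hq ⊢
      rw [← hq]
      noncomm_ring
    have := key q _ (sub_ne_zero.2 hne) hu
    rwa [hq, sub_self, neg_zero, sub_eq_zero] at this
  · rintro (rfl | h)
    · rfl
    · have := key q _ hd h
      rwa [h, sub_self, eq_comm, neg_eq_zero, sub_eq_zero] at this
end

section
/- Let f : ℍ → ℍ be given by f(q) = q² + qi, and let 𝛤 = {x₀ + x₂j + x₃k : x₀, x₂, x₃ ∈ ℝ, x₀ = 1/4 − (x₂² + x₃²)} be the paraboloid of revolution in the 3-space ℝ + ℝj + ℝk. Then for every c ∈ ℍ the fibre {q ∈ ℍ : q² + qi = c} is nonempty and finite, it has exactly one element if c ∈ 𝛤, and it has exactly two elements if c ∉ 𝛤. In particular f : ℍ → ℍ is surjective and is a double covering branched over 𝛤. -/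
open Quaternion

/-- The paraboloid of revolution `𝛤 = {x₀ + x₂j + x₃k : x₀ = 1/4 - (x₂² + x₃²)}`
in the 3-space `ℝ + ℝj + ℝk`. -/
def Paraboloid : Set ℍ :=
  {q : ℍ | q.imI = 0 ∧ q.re = 1 / 4 - (q.imJ ^ 2 + q.imK ^ 2)}

/-- Simultaneous solvability of `s r = m²` and `s / 4 - r - P / (1 + s) = K` in nonnegative reals. -/
lemma exists_nonneg_mul_eq_sq (m P K : ℝ) (hP : 0 ≤ P) :
    ∃ s r : ℝ, 0 ≤ s ∧ 0 ≤ r ∧ s * r = m ^ 2 ∧ s / 4 - r - P / (1 + s) = K := by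
  have hcont (S : ℝ) : ContinuousOn (fun s : ℝ => s / 4 - P / (1 + s) - K) (Set.Icc 0 S) := by
    refine ((continuousOn_id.div_const 4).sub (continuousOn_const.div ?_ ?_)).sub continuousOn_const
    · exact continuousOn_const.add continuousOn_id
    · intro x hx
      have := hx.1
      positivity
  have hlarge (s : ℝ) (hs : 0 ≤ s) : s / 4 - P - K ≤ s / 4 - P / (1 + s) - K := by
    have : P / (1 + s) ≤ P := div_le_self hP (by linarith)
    linarith
  set S : ℝ := 4 * (P + |K| + m ^ 2 + 1) with hS
  have hS1 : 1 ≤ S := by nlinarith [abs_nonneg K, sq_nonneg m]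
  have hSm : m ^ 2 ≤ S / 4 - P / (1 + S) - K := by
    have := hlarge S (by linarith)
    linarith [le_abs_self K]
  by_cases hm : m = 0
  · subst hm
    by_cases hK : 0 ≤ -P - K
    · exact ⟨0, -P - K, le_rfl, hK, by simp, by simp⟩
    · obtain ⟨s, hs, h⟩ := intermediate_value_Icc (by linarith : (0 : ℝ) ≤ S) (hcont S)
        (show (0 : ℝ) ∈ Set.Icc _ _ from ⟨by simp; linarith, by simpa using hSm⟩)
      refine ⟨s, 0, hs.1, le_rfl, by simp, ?_⟩
      linarith
  · obtain ⟨s, hs, h⟩ := intermediate_value_Icc (by linarith : (0 : ℝ) ≤ S)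
      (continuousOn_id.mul (hcont S))
      (show m ^ 2 ∈ Set.Icc _ _ from ⟨by simp; positivity, by
        change m ^ 2 ≤ S * (S / 4 - P / (1 + S) - K)
        nlinarith [sq_nonneg m]⟩)
    change s * (s / 4 - P / (1 + s) - K) = m ^ 2 at h
    refine ⟨s, s / 4 - P / (1 + s) - K, hs.1, ?_, h, by ring⟩
    have hm2 : 0 < m ^ 2 := by positivity
    exact (pos_of_mul_pos_right (h ▸ hm2) hs.1).le

/-- The real system obtained from `q² + qi = c` with `t = 2 Re q` and `B = 1/2 + (i-part of q)`
has a solution. -/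
lemma exists_mul_eq_and_eq (m P K : ℝ) (hP : 0 ≤ P) :
    ∃ t B : ℝ, t * B = m ∧ t ^ 2 / 4 - B ^ 2 - P / (1 + t ^ 2) = K := by
  obtain ⟨s, r, hs, hr, hsr, h⟩ := exists_nonneg_mul_eq_sq m P K hP
  have habs : √s * √r = |m| := by
    rw [← Real.sqrt_mul hs, hsr, Real.sqrt_sq_eq_abs]
  rcases abs_choice m with hm | hm
  · exact ⟨√s, √r, by rw [habs, hm], by rw [Real.sq_sqrt hs, Real.sq_sqrt hr, h]⟩
  · exact ⟨√s, -√r, by rw [mul_neg, habs, hm, neg_neg],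
      by rw [neg_sq, Real.sq_sqrt hs, Real.sq_sqrt hr, h]⟩

lemma sq_le_sq_of_system {P K t B t' B' : ℝ} (hP : 0 ≤ P) (hm : t * B = t' * B')
    (h : t ^ 2 / 4 - B ^ 2 - P / (1 + t ^ 2) = K)
    (h' : t' ^ 2 / 4 - B' ^ 2 - P / (1 + t' ^ 2) = K) : t' ^ 2 ≤ t ^ 2 := by
  by_contra! hlt
  have hdiv : P / (1 + t' ^ 2) ≤ P / (1 + t ^ 2) := by gcongr
  have hB : B ^ 2 < B' ^ 2 := by linarith
  have : t ^ 2 * B ^ 2 = t' ^ 2 * B' ^ 2 := by rw [← mul_pow, hm, mul_pow]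
  nlinarith [sq_nonneg t, sq_nonneg B]

/-- The solution of the real system is unique up to a common sign. -/
lemma eq_or_eq_neg_of_system {P K t B t' B' : ℝ} (hP : 0 ≤ P) (hm : t * B = t' * B')
    (h : t ^ 2 / 4 - B ^ 2 - P / (1 + t ^ 2) = K)
    (h' : t' ^ 2 / 4 - B' ^ 2 - P / (1 + t' ^ 2) = K) :
    (t' = t ∧ B' = B) ∨ (t' = -t ∧ B' = -B) := by
  have ht : t' ^ 2 = t ^ 2 :=
    le_antisymm (sq_le_sq_of_system hP hm h h') (sq_le_sq_of_system hP hm.symm h' h)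
  have hB : B' ^ 2 = B ^ 2 := by rw [ht] at h'; linarith
  by_cases h0 : t = 0
  · have h0' : t' = 0 := by simpa [h0] using ht
    rcases sq_eq_sq_iff_eq_or_eq_neg.mp hB with hB | hB <;> simp [h0, h0', hB]
  · rcases sq_eq_sq_iff_eq_or_eq_neg.mp ht with rfl | rfl
    · exact Or.inl ⟨rfl, (mul_left_cancel₀ h0 hm).symm⟩
    · refine Or.inr ⟨rfl, mul_left_cancel₀ h0 ?_⟩
      linarith

/-- The point with real part `t / 2` and `i`-part `B - 1/2` whose image under `q ↦ q² + qi` has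
the same `j`- and `k`-parts as `c`. -/
noncomputable def fibrePoint (c : ℍ) (t B : ℝ) : ℍ :=
  ⟨t / 2, B - 1 / 2, (t * c.imJ - c.imK) / (1 + t ^ 2), (c.imJ + t * c.imK) / (1 + t ^ 2)⟩

lemma sq_add_mul_qi_eq_iff_components (q c : ℍ) :
    q ^ 2 + q * qi = c ↔
      q.re ^ 2 - q.imI ^ 2 - q.imJ ^ 2 - q.imK ^ 2 - q.imI = c.re ∧
      2 * q.re * q.imI + q.re = c.imI ∧
      2 * q.re * q.imJ + q.imK = c.imJ ∧
      2 * q.re * q.imK - q.imJ = c.imK := by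
  rw [pow_two, Quaternion.ext_iff]
  simp only [Quaternion.re_add, Quaternion.imI_add, Quaternion.imJ_add, Quaternion.imK_add,
    Quaternion.re_mul, Quaternion.imI_mul, Quaternion.imJ_mul, Quaternion.imK_mul]
  simp only [qi]
  ring_nf

lemma sq_add_mul_qi_eq_iff (q c : ℍ) :
    q ^ 2 + q * qi = c ↔ ∃ t B : ℝ, t * B = c.imI ∧
      t ^ 2 / 4 - B ^ 2 - (c.imJ ^ 2 + c.imK ^ 2) / (1 + t ^ 2) = c.re - 1 / 4 ∧
      q = fibrePoint c t B := by
  refine (sq_add_mul_qi_eq_iff_components q c).trans ⟨?_, ?_⟩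
  · rintro ⟨h0, h1, h2, h3⟩
    have hpos : 1 + (2 * q.re) ^ 2 ≠ 0 := by positivity
    refine ⟨2 * q.re, q.imI + 1 / 2, by linarith, ?_, ?_⟩
    · rw [← h0, ← h2, ← h3]
      field_simp
      ring
    · apply Quaternion.ext <;> simp only [fibrePoint, ← h2, ← h3] <;> field_simp <;> ring
  · rintro ⟨t, B, h1, h0, rfl⟩
    have hpos : 1 + t ^ 2 ≠ 0 := by positivity
    have hnorm : (c.imJ ^ 2 + c.imK ^ 2) / (1 + t ^ 2) =
        ((t * c.imJ - c.imK) / (1 + t ^ 2)) ^ 2 + ((c.imJ + t * c.imK) / (1 + t ^ 2)) ^ 2 := by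
      field_simp
      ring
    simp only [fibrePoint]
    refine ⟨by linarith, by linarith, ?_, ?_⟩ <;> field_simp <;> ring

/-- Every fibre is a pair of points interchanged by `(t, B) ↦ (-t, -B)`. -/
lemma exists_fibre_eq_pair (c : ℍ) :
    ∃ t B : ℝ, t * B = c.imI ∧
      t ^ 2 / 4 - B ^ 2 - (c.imJ ^ 2 + c.imK ^ 2) / (1 + t ^ 2) = c.re - 1 / 4 ∧
      {q : ℍ | q ^ 2 + q * qi = c} = {fibrePoint c t B, fibrePoint c (-t) (-B)} := by
  have hP : 0 ≤ c.imJ ^ 2 + c.imK ^ 2 := by positivity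
  obtain ⟨t, B, hm, h⟩ := exists_mul_eq_and_eq c.imI _ (c.re - 1 / 4) hP
  refine ⟨t, B, hm, h, Set.ext fun q => ?_⟩
  simp only [Set.mem_ofPred_eq, Set.mem_insert_iff, Set.mem_singleton_iff, sq_add_mul_qi_eq_iff]
  constructor
  · rintro ⟨t', B', hm', h', rfl⟩
    rcases eq_or_eq_neg_of_system hP (hm.trans hm'.symm) h h' with ⟨rfl, rfl⟩ | ⟨rfl, rfl⟩
    · exact Or.inl rfl
    · exact Or.inr rfl
  · rintro (rfl | rfl)
    · exact ⟨t, B, hm, h, rfl⟩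
    · exact ⟨-t, -B, by rw [neg_mul_neg, hm], by rw [neg_sq, neg_sq, h], rfl⟩

lemma fibrePoint_eq_fibrePoint_neg_iff (c : ℍ) (t B : ℝ) :
    fibrePoint c t B = fibrePoint c (-t) (-B) ↔ t = 0 ∧ B = 0 := by
  constructor
  · intro h
    have h0 := congrArg QuaternionAlgebra.re h
    have h1 := congrArg QuaternionAlgebra.imI h
    simp only [fibrePoint] at h0 h1
    constructor <;> linarith
  · rintro ⟨rfl, rfl⟩
    simp

/-- `c` lies on the paraboloid exactly when the real system has the trivial solution. -/
lemma mem_Paraboloid_iff {c : ℍ} {t B : ℝ} (hm : t * B = c.imI)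
    (h : t ^ 2 / 4 - B ^ 2 - (c.imJ ^ 2 + c.imK ^ 2) / (1 + t ^ 2) = c.re - 1 / 4) :
    c ∈ Paraboloid ↔ t = 0 ∧ B = 0 := by
  constructor
  · rintro ⟨hI, hre⟩
    have hP : 0 ≤ c.imJ ^ 2 + c.imK ^ 2 := by positivity
    have h00 : (0 : ℝ) ^ 2 / 4 - 0 ^ 2 - (c.imJ ^ 2 + c.imK ^ 2) / (1 + 0 ^ 2) = c.re - 1 / 4 := by
      rw [hre]
      ring
    simpa using eq_or_eq_neg_of_system hP (by rw [hm, hI, mul_zero]) h00 h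
  · rintro ⟨rfl, rfl⟩
    refine ⟨by simpa using hm.symm, ?_⟩
    norm_num at h
    linarith

/-- For `f(q) = q² + qi`, every fibre `{q : q² + qi = c}` is nonempty and
finite; it has exactly one element if `c ∈ 𝛤` and exactly two elements if `c ∉ 𝛤`.
Thus `f` is a surjective double covering branched over `𝛤`. -/
theorem statement9 :
    ∀ c : ℍ,
      {q : ℍ | q ^ 2 + q * qi = c}.Nonempty ∧
      {q : ℍ | q ^ 2 + q * qi = c}.Finite ∧
      (c ∈ Paraboloid → {q : ℍ | q ^ 2 + q * qi = c}.ncard = 1) ∧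
      (c ∉ Paraboloid → {q : ℍ | q ^ 2 + q * qi = c}.ncard = 2) := by
  intro c
  obtain ⟨t, B, hm, h, hfib⟩ := exists_fibre_eq_pair c
  rw [hfib, mem_Paraboloid_iff hm h, ← fibrePoint_eq_fibrePoint_neg_iff c]
  refine ⟨Set.insert_nonempty _ _, Set.toFinite _, fun heq => ?_, fun hne => Set.ncard_pair hne⟩
  rw [← heq, Set.pair_eq_singleton, Set.ncard_singleton]
end

section
/- Let f : ℍ → ℍ be given by f(q) = q² + qi and let ℍ⁺ = {q ∈ ℍ : Re(q) > 0} be the open right half-space. Then f restricted to ℍ⁺ is injective, and its image is the complement of the closed solid paraboloid: {q² + qi : q ∈ ℍ⁺} = ℍ ∖ P𝛤, where P𝛤 = {x₀ + x₂j + x₃k : x₀, x₂, x₃ ∈ ℝ, x₀ ≤ 1/4 − (x₂² + x₃²)}. -/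
open Quaternion

/-- The closed solid paraboloid `P𝛤 = {x₀ + x₂j + x₃k : x₀ ≤ 1/4 - (x₂² + x₃²)}`
in the 3-space `ℝ + ℝj + ℝk`. -/
def SolidParaboloid : Set ℍ :=
  {q : ℍ | q.imI = 0 ∧ q.re ≤ 1 / 4 - (q.imJ ^ 2 + q.imK ^ 2)}

/-- The equation `q² + qi = w` in coordinates. -/
lemma sq_add_mul_qi_eq_iff_s12 (q w : ℍ) :
    q ^ 2 + q * qi = w ↔
      q.re ^ 2 - q.imI ^ 2 - q.imI - q.imJ ^ 2 - q.imK ^ 2 = w.re ∧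
      q.re * (2 * q.imI + 1) = w.imI ∧
      2 * q.re * q.imJ + q.imK = w.imJ ∧
      2 * q.re * q.imK - q.imJ = w.imK := by
  have h0 : qi.re = 0 := rfl
  have h1 : qi.imI = 1 := rfl
  have h2 : qi.imJ = 0 := rfl
  have h3 : qi.imK = 0 := rfl
  rw [Quaternion.ext_iff]
  simp only [pow_two, Quaternion.re_add, Quaternion.imI_add, Quaternion.imJ_add,
    Quaternion.imK_add, Quaternion.re_mul, Quaternion.imI_mul, Quaternion.imJ_mul,
    Quaternion.imK_mul, h0, h1, h2, h3]
  ring_nf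

/-- The real part of a point of the right half-space is determined monotonically by
the value of `q² + qi`. -/
lemma re_le_of_sq_add_mul_qi_eq {p q : ℍ} (hp : 0 < p.re) (hq : 0 < q.re)
    (h : p ^ 2 + p * qi = q ^ 2 + q * qi) : q.re ≤ p.re := by
  obtain ⟨h0, h1, h2, h3⟩ := (sq_add_mul_qi_eq_iff_s12 p _).1 h
  obtain ⟨k0, k1, k2, k3⟩ := (sq_add_mul_qi_eq_iff_s12 q _).1 rfl
  rw [← k0] at h0
  rw [← k1] at h1
  rw [← k2] at h2
  rw [← k3] at h3
  clear k0 k1 k2 k3 h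
  obtain ⟨a, b, c, d⟩ := p
  obtain ⟨a', b', c', d'⟩ := q
  simp only at h0 h1 h2 h3 hp hq ⊢
  by_contra! hlt
  have hsq : a ^ 2 < a' ^ 2 := by gcongr
  have hB : (2 * b' + 1) ^ 2 ≤ (2 * b + 1) ^ 2 := by
    have e : a ^ 2 * (2 * b + 1) ^ 2 = a' ^ 2 * (2 * b' + 1) ^ 2 := by
      rw [← mul_pow, h1, mul_pow]
    by_contra! hc
    have : a ^ 2 * (2 * b + 1) ^ 2 < a' ^ 2 * (2 * b' + 1) ^ 2 := by gcongr
    exact this.ne e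
  have hN : c' ^ 2 + d' ^ 2 ≤ c ^ 2 + d ^ 2 := by
    have e : (4 * a ^ 2 + 1) * (c ^ 2 + d ^ 2) = (4 * a' ^ 2 + 1) * (c' ^ 2 + d' ^ 2) := by
      linear_combination (2 * a * c + d + (2 * a' * c' + d')) * h2 +
        (2 * a * d - c + (2 * a' * d' - c')) * h3
    by_contra! hc
    have : (4 * a ^ 2 + 1) * (c ^ 2 + d ^ 2) < (4 * a' ^ 2 + 1) * (c' ^ 2 + d' ^ 2) := by
      gcongr
    exact this.ne e
  linarith

lemma injOn_sq_add_mul_qi :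
    Set.InjOn (fun q : ℍ => q ^ 2 + q * qi) {q : ℍ | 0 < q.re} := by
  intro p hp q hq h
  have hre := le_antisymm (re_le_of_sq_add_mul_qi_eq hq hp h.symm)
    (re_le_of_sq_add_mul_qi_eq hp hq h)
  obtain ⟨-, h1, h2, h3⟩ := (sq_add_mul_qi_eq_iff_s12 p _).1 h
  obtain ⟨-, k1, k2, k3⟩ := (sq_add_mul_qi_eq_iff_s12 q _).1 rfl
  rw [← k1, ← hre] at h1
  rw [← k2, ← hre] at h2
  rw [← k3, ← hre] at h3
  have hpos : 4 * p.re ^ 2 + 1 ≠ 0 := by positivity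
  have hp0 : p.re ≠ 0 := ne_of_gt hp
  refine Quaternion.ext_iff.2 ⟨hre, ?_, mul_left_cancel₀ hpos ?_,
    mul_left_cancel₀ hpos ?_⟩
  · linarith [mul_left_cancel₀ hp0 h1]
  · linear_combination 2 * p.re * h2 - h3
  · linear_combination h2 + 2 * p.re * h3

/-- The equation satisfied by `4 (Re q)²` when `q² + qi` has real part `x`, `i`-part `y` and
squared `(j, k)`-part `s` has a positive solution as soon as `y ≠ 0` or `1 / 4 - s < x`. -/
lemma exists_pos_root (x y s : ℝ) (hs : 0 ≤ s) (h : y = 0 → 1 / 4 - s < x) :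
    ∃ t : ℝ, 0 < t ∧ t / 4 - y ^ 2 / t + 1 / 4 - s / (t + 1) = x := by
  set T : ℝ := 1 + 4 * s + 4 * y ^ 2 + 4 * |x| with hT
  have hx := le_abs_self x
  have hx0 := abs_nonneg x
  have hy0 := sq_nonneg y
  have hT1 : 1 ≤ T := by linarith
  by_cases hy : y = 0
  · have hlt := h hy
    let g : ℝ → ℝ := fun t => (t + 1) ^ 2 - 4 * s - 4 * x * (t + 1)
    have hg : ContinuousOn g (Set.Icc 0 T) := by fun_prop
    have hgT : 0 ≤ g T := by
      have : 0 ≤ (T + 1) * (T - 4 * x - 4 * s) := mul_nonneg (by linarith) (by linarith)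
      have : 0 ≤ s * T := by positivity
      simp only [g]
      nlinarith
    obtain ⟨t, ht, hgt⟩ := intermediate_value_Icc (by linarith) hg
      ⟨show g 0 ≤ 0 by simp only [g]; linarith, hgT⟩
    have ht0 : 0 < t := by
      refine lt_of_le_of_ne ht.1 ?_
      rintro rfl
      simp only [g] at hgt
      linarith
    refine ⟨t, ht0, ?_⟩
    simp only [g] at hgt
    rw [hy]
    field_simp
    linear_combination t * hgt
  · let g : ℝ → ℝ := fun t =>
      t * (t + 1) ^ 2 - 4 * s * t - 4 * y ^ 2 * (t + 1) - 4 * x * t * (t + 1)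
    have hg : ContinuousOn g (Set.Icc 0 T) := by fun_prop
    have hypos : 0 < y ^ 2 := by positivity
    have hgT : 0 ≤ g T := by
      have h1 : 0 ≤ T * (T + 1) * (T - 4 * x - 4 * s - 4 * y ^ 2) :=
        mul_nonneg (by positivity) (by linarith)
      have h2 : 0 ≤ s * T * T := by positivity
      have h3 : 0 ≤ y ^ 2 * (T + 1) * (T - 1) := mul_nonneg (by positivity) (by linarith)
      simp only [g]
      nlinarith
    obtain ⟨t, ht, hgt⟩ := intermediate_value_Icc (by linarith) hg
      ⟨show g 0 ≤ 0 by simp only [g]; linarith, hgT⟩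
    have ht0 : 0 < t := by
      refine lt_of_le_of_ne ht.1 ?_
      rintro rfl
      simp only [g] at hgt
      linarith
    refine ⟨t, ht0, ?_⟩
    simp only [g] at hgt
    field_simp
    linear_combination hgt

lemma sq_add_mul_qi_notMem_solidParaboloid {q : ℍ} (hq : 0 < q.re) :
    q ^ 2 + q * qi ∉ SolidParaboloid := by
  obtain ⟨k0, k1, k2, k3⟩ := (sq_add_mul_qi_eq_iff_s12 q _).1 rfl
  rintro ⟨h1, h2⟩
  rw [← k1] at h1
  rw [← k0, ← k2, ← k3] at h2
  clear k0 k1 k2 k3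
  obtain ⟨a, b, c, d⟩ := q
  simp only at hq h1 h2
  have hb : b = -1 / 2 := by
    rcases mul_eq_zero.1 h1 with h | h <;> linarith
  subst hb
  have : 0 < a ^ 2 := by positivity
  have : 0 ≤ a ^ 2 * (c ^ 2 + d ^ 2) := by positivity
  nlinarith

lemma exists_sq_add_mul_qi_eq {w : ℍ} (hw : w ∉ SolidParaboloid) :
    ∃ q : ℍ, 0 < q.re ∧ q ^ 2 + q * qi = w := by
  obtain ⟨x, y, u, v⟩ := w
  have h : y = 0 → 1 / 4 - (u ^ 2 + v ^ 2) < x := fun hy =>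
    not_le.1 fun hle => hw ⟨hy, hle⟩
  obtain ⟨t, ht, hroot⟩ := exists_pos_root x y (u ^ 2 + v ^ 2) (by positivity) h
  obtain ⟨a, ha, rfl⟩ : ∃ a : ℝ, 0 < a ∧ t = 4 * a ^ 2 := by
    refine ⟨√t / 2, by positivity, ?_⟩
    rw [div_pow, Real.sq_sqrt ht.le]
    ring
  have hpos : 4 * a ^ 2 + 1 ≠ 0 := by positivity
  refine ⟨⟨a, y / (2 * a) - 1 / 2, (2 * a * u - v) / (4 * a ^ 2 + 1),
    (u + 2 * a * v) / (4 * a ^ 2 + 1)⟩, ha, ?_⟩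
  refine (sq_add_mul_qi_eq_iff_s12 _ _).2 ?_
  simp only [← hroot]
  refine ⟨?_, ?_, ?_, ?_⟩ <;> field_simp <;> ring

/-- The map `f(q) = q² + qi` is injective on the open right half-space
`ℍ⁺ = {Re q > 0}`, with image the complement of the closed solid paraboloid `P𝛤`. -/
theorem statement12 :
    Set.InjOn (fun q : ℍ => q ^ 2 + q * qi) {q : ℍ | 0 < q.re} ∧
    (fun q : ℍ => q ^ 2 + q * qi) '' {q : ℍ | 0 < q.re} = SolidParaboloidᶜ := by
  refine ⟨injOn_sq_add_mul_qi, Set.Subset.antisymm ?_ fun w hw => exists_sq_add_mul_qi_eq hw⟩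
  rintro _ ⟨q, hq, rfl⟩
  exact sq_add_mul_qi_notMem_solidParaboloid hq
end
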